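/- For every finite nonempty Λ ⊆ V and every q : Λ → ℝ, λ_Λ(q; G) = sup{ Σ_{x ∈ Λ} q(x) p(x) − I_E(p) : p ∈ 𝒫(V), supp(p) ⊆ Λ }. -/

import Mathlib

open scoped ENNReal BigOperators

/-- degree of a vertex (cardinality of the neighbour set) -/
noncomputable def degR {V : Type*} (G : SimpleGraph V) (x : V) : ℝ :=
  ((G.neighborSet x).ncard : ℝ)

/-- normalised Laplacian -/
noncomputable def lapl {V : Type*} (G : SimpleGraph V) (f : V → ℝ) (x : V) : ℝ :=
  (1 / degR G x) * ∑ᶠ y ∈ G.neighborSet x, (f y - f x)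

/-- degree-weighted inner product -/
noncomputable def dInner {V : Type*} (G : SimpleGraph V) (φ ψ : V → ℝ) : ℝ :=
  ∑ᶠ x, degR G x * φ x * ψ x

/-- principal Dirichlet eigenvalue of `Δ + q` on the finite set `Λ`,
via the Rayleigh–Ritz formula -/
noncomputable def pev {V : Type*} (G : SimpleGraph V) (Λ : Finset V) (q : V → ℝ) : ℝ :=
  sSup { r | ∃ φ : V → ℝ, (∀ x ∉ Λ, φ x = 0) ∧ dInner G φ φ = 1 ∧
    r = ∑ x ∈ Λ, degR G x * (lapl G φ x + q x * φ x) * φ x }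

/-- the functional `I_E(p)` (real-valued version, for finitely supported `p`) -/
noncomputable def IEdgeR {V : Type*} (G : SimpleGraph V) (p : V → ℝ) : ℝ :=
  ∑ᶠ e : G.edgeSet,
    Sym2.lift ⟨fun x y => (Real.sqrt (p x / degR G x) - Real.sqrt (p y / degR G y)) ^ 2,
      fun x y => by ring⟩ e.1

open Classical in
/-- There is a finite set of oriented edges of `G`, closed under reversal, which contains every
oriented edge starting in `Λ`. -/
theorem exists_symm_finset_darts {V : Type*} (G : SimpleGraph V)
    (hlf : ∀ x, (G.neighborSet x).Finite) (Λ : Finset V) :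
    ∃ D : Finset (V × V), (∀ x y, (x, y) ∈ D → G.Adj x y) ∧ (∀ x y, (x, y) ∈ D → (y, x) ∈ D) ∧
      ∀ x ∈ Λ, ∀ y, G.Adj x y → (x, y) ∈ D := by
  let S : Finset V := Λ ∪ Λ.biUnion fun x => (hlf x).toFinset
  refine ⟨(S ×ˢ S).filter fun d => G.Adj d.1 d.2, ?_, ?_, ?_⟩
  · intro x y h
    exact (Finset.mem_filter.1 h).2
  · intro x y h
    simp only [Finset.mem_filter, Finset.mem_product] at h ⊢
    exact ⟨⟨h.1.2, h.1.1⟩, h.2.symm⟩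
  · intro x hx y hxy
    simp only [Finset.mem_filter, Finset.mem_product, S, Finset.mem_union, Finset.mem_biUnion,
      Set.Finite.mem_toFinset, SimpleGraph.mem_neighborSet]
    exact ⟨⟨Or.inl hx, Or.inr ⟨x, hx, hxy⟩⟩, hxy⟩

/-- The squared difference of `φ` along an unordered pair. -/
def sqDiff {V : Type*} (φ : V → ℝ) : Sym2 V → ℝ :=
  Sym2.lift ⟨fun x y => (φ x - φ y) ^ 2, fun x y => by ring⟩

@[simp]
theorem sqDiff_mk {V : Type*} (φ : V → ℝ) (x y : V) : sqDiff φ s(x, y) = (φ x - φ y) ^ 2 := rfl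

theorem sqDiff_nonneg {V : Type*} (φ : V → ℝ) (e : Sym2 V) : 0 ≤ sqDiff φ e := by
  induction e with | _ x y => exact sq_nonneg _

theorem sqDiff_abs_le {V : Type*} (φ : V → ℝ) (e : Sym2 V) :
    sqDiff (fun x => |φ x|) e ≤ sqDiff φ e := by
  induction e with
  | _ x y => exact sq_le_sq.2 (abs_abs_sub_abs_le (φ x) (φ y))

/-- The Dirichlet energy of `φ`. -/
noncomputable def edgeEnergy {V : Type*} (G : SimpleGraph V) (φ : V → ℝ) : ℝ :=
  ∑ᶠ e : G.edgeSet, sqDiff φ e.1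

theorem edgeEnergy_nonneg {V : Type*} (G : SimpleGraph V) (φ : V → ℝ) : 0 ≤ edgeEnergy G φ :=
  finsum_nonneg fun e => sqDiff_nonneg φ e.1

theorem weighted_sum_sub_edgeEnergy_le {V : Type*} (G : SimpleGraph V) {Λ : Finset V}
    (q φ : V → ℝ) {p : V → ℝ} (hp : ∀ x ∈ Λ, 0 ≤ p x) (hsum : ∑ x ∈ Λ, p x = 1) :
    ∑ x ∈ Λ, q x * p x - edgeEnergy G φ ≤ ∑ x ∈ Λ, |q x| := by
  refine (sub_le_self _ (edgeEnergy_nonneg G φ)).trans (Finset.sum_le_sum fun x hx => ?_)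
  exact (mul_le_mul_of_nonneg_right (le_abs_self _) (hp x hx)).trans
    (mul_le_of_le_one_right (abs_nonneg _) (hsum ▸ Finset.single_le_sum hp hx))

theorem IEdgeR_eq_edgeEnergy {V : Type*} (G : SimpleGraph V) (p : V → ℝ) :
    IEdgeR G p = edgeEnergy G fun x => Real.sqrt (p x / degR G x) := rfl

open Classical in
theorem edgeEnergy_eq_sum {V : Type*} (G : SimpleGraph V) {Λ : Finset V} {D : Finset (V × V)}
    (hadj : ∀ x y, (x, y) ∈ D → G.Adj x y) (hsymm : ∀ x y, (x, y) ∈ D → (y, x) ∈ D)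
    (hmem : ∀ x ∈ Λ, ∀ y, G.Adj x y → (x, y) ∈ D) {φ : V → ℝ} (hφ : ∀ x ∉ Λ, φ x = 0) :
    edgeEnergy G φ = ∑ e ∈ D.image fun d => s(d.1, d.2), sqDiff φ e := by
  rw [edgeEnergy, finsum_set_coe_eq_finsum_mem (f := sqDiff φ)]
  apply finsum_mem_eq_sum_of_inter_support_eq
  ext e
  induction e with | _ x y =>
  simp only [Set.mem_inter_iff, SimpleGraph.mem_edgeSet, Function.mem_support, Finset.mem_coe]
  refine and_congr_left fun hne => ⟨fun h => ?_, fun h => ?_⟩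
  · by_cases hx : x ∈ Λ
    · exact Finset.mem_image_of_mem (fun d : V × V => s(d.1, d.2)) (hmem x hx y h)
    · by_cases hy : y ∈ Λ
      · exact Finset.mem_image_of_mem (fun d : V × V => s(d.1, d.2))
          (hsymm _ _ (hmem y hy x h.symm))
      · simp [hφ x hx, hφ y hy] at hne
  · obtain ⟨⟨a, b⟩, hab, he⟩ := Finset.mem_image.1 h
    rw [← SimpleGraph.mem_edgeSet, ← he]
    exact hadj a b hab

theorem edgeEnergy_abs_le {V : Type*} (G : SimpleGraph V) (hlf : ∀ x, (G.neighborSet x).Finite)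
    {Λ : Finset V} {φ : V → ℝ} (hφ : ∀ x ∉ Λ, φ x = 0) :
    edgeEnergy G (fun x => |φ x|) ≤ edgeEnergy G φ := by
  obtain ⟨D, h₁, h₂, h₃⟩ := exists_symm_finset_darts G hlf Λ
  rw [edgeEnergy_eq_sum G h₁ h₂ h₃ hφ,
    edgeEnergy_eq_sum G h₁ h₂ h₃ (φ := fun x => |φ x|) fun x hx => by simp [hφ x hx]]
  exact Finset.sum_le_sum fun e _ => sqDiff_abs_le φ e

open Classical in
theorem edgeEnergy_eq_sum_darts {V : Type*} (G : SimpleGraph V) {Λ : Finset V}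
    {D : Finset (V × V)} (hadj : ∀ x y, (x, y) ∈ D → G.Adj x y)
    (hsymm : ∀ x y, (x, y) ∈ D → (y, x) ∈ D)
    (hmem : ∀ x ∈ Λ, ∀ y, G.Adj x y → (x, y) ∈ D) {φ : V → ℝ} (hφ : ∀ x ∉ Λ, φ x = 0) :
    edgeEnergy G φ = ∑ d ∈ D, φ d.1 * (φ d.1 - φ d.2) := by
  rw [edgeEnergy_eq_sum G hadj hsymm hmem hφ,
    ← Finset.sum_fiberwise_of_maps_to (t := D.image fun d : V × V => s(d.1, d.2))
      (g := fun d : V × V => s(d.1, d.2)) fun d hd => Finset.mem_image_of_mem _ hd]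
  refine Finset.sum_congr rfl fun e he => ?_
  obtain ⟨⟨x, y⟩, hxy, rfl⟩ := Finset.mem_image.1 he
  have hfib : (D.filter fun d => s(d.1, d.2) = s(x, y)) = {(x, y), (y, x)} := by
    ext ⟨a, b⟩
    simp only [Finset.mem_filter, Finset.mem_insert, Finset.mem_singleton, Prod.mk.injEq,
      Sym2.eq_iff]
    refine ⟨And.right, fun h => ⟨?_, h⟩⟩
    rcases h with ⟨rfl, rfl⟩ | ⟨rfl, rfl⟩
    exacts [hxy, hsymm _ _ hxy]
  have hne : ((x, y) : V × V) ≠ (y, x) := fun h => (hadj x y hxy).ne (Prod.mk.inj h).1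
  rw [hfib, Finset.sum_pair hne, sqDiff_mk]
  ring

theorem degR_pos {V : Type*} (G : SimpleGraph V) (hlf : ∀ x, (G.neighborSet x).Finite)
    (hdeg : ∀ x, (G.neighborSet x).Nonempty) (x : V) : 0 < degR G x :=
  Nat.cast_pos.2 ((Set.ncard_pos (hlf x)).2 (hdeg x))

open Classical in
/-- Summation by parts. -/
theorem sum_degR_mul_lapl_mul {V : Type*} (G : SimpleGraph V)
    (hlf : ∀ x, (G.neighborSet x).Finite) (hdeg : ∀ x, (G.neighborSet x).Nonempty)
    {Λ : Finset V} {φ : V → ℝ} (hφ : ∀ x ∉ Λ, φ x = 0) :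
    ∑ x ∈ Λ, degR G x * lapl G φ x * φ x = -edgeEnergy G φ := by
  obtain ⟨D, h₁, h₂, h₃⟩ := exists_symm_finset_darts G hlf Λ
  have hD : ∑ d ∈ D, φ d.1 * (φ d.1 - φ d.2)
      = ∑ d ∈ Λ.sigma fun x => (hlf x).toFinset, φ d.1 * (φ d.1 - φ d.2) := by
    rw [← Finset.sum_filter_of_ne (p := fun d : V × V => d.1 ∈ Λ)]
    · refine Finset.sum_bij' (fun d _ => (⟨d.1, d.2⟩ : Σ _ : V, V)) (fun d _ => (d.1, d.2))
        ?_ ?_ (fun _ _ => rfl) (fun _ _ => rfl) (fun _ _ => rfl)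
      · rintro ⟨x, y⟩ h
        obtain ⟨h, hx⟩ := Finset.mem_filter.1 h
        simpa using ⟨hx, h₁ x y h⟩
      · rintro ⟨x, y⟩ h
        simp only [Finset.mem_sigma, Set.Finite.mem_toFinset, SimpleGraph.mem_neighborSet] at h
        exact Finset.mem_filter.2 ⟨h₃ x h.1 y h.2, h.1⟩
    · intro d _ hd
      by_contra hx
      exact hd (by rw [hφ _ hx, zero_mul])
  rw [edgeEnergy_eq_sum_darts G h₁ h₂ h₃ hφ, hD, Finset.sum_sigma, ← Finset.sum_neg_distrib]
  refine Finset.sum_congr rfl fun x _ => ?_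
  rw [lapl, finsum_mem_eq_finite_toFinset_sum _ (hlf x), ← mul_assoc,
    mul_one_div_cancel (degR_pos G hlf hdeg x).ne', one_mul, Finset.sum_mul,
    ← Finset.sum_neg_distrib]
  exact Finset.sum_congr rfl fun y _ => by ring

theorem sum_degR_mul_lapl_add_mul {V : Type*} (G : SimpleGraph V)
    (hlf : ∀ x, (G.neighborSet x).Finite) (hdeg : ∀ x, (G.neighborSet x).Nonempty)
    {Λ : Finset V} (q : V → ℝ) {φ : V → ℝ} (hφ : ∀ x ∉ Λ, φ x = 0) :
    ∑ x ∈ Λ, degR G x * (lapl G φ x + q x * φ x) * φ x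
      = ∑ x ∈ Λ, q x * (degR G x * φ x ^ 2) - edgeEnergy G φ := by
  rw [sub_eq_add_neg, ← sum_degR_mul_lapl_mul G hlf hdeg hφ, ← Finset.sum_add_distrib]
  exact Finset.sum_congr rfl fun x _ => by ring

theorem dInner_self_eq_sum {V : Type*} (G : SimpleGraph V) {Λ : Finset V} {φ : V → ℝ}
    (hφ : ∀ x ∉ Λ, φ x = 0) : dInner G φ φ = ∑ x ∈ Λ, degR G x * φ x ^ 2 := by
  rw [dInner, finsum_eq_sum_of_support_subset (s := Λ)]
  · exact Finset.sum_congr rfl fun x _ => by ring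
  · intro x hx
    by_contra h
    exact hx (by simp [hφ x h])

/-- the Rayleigh–Ritz principal eigenvalue equals the Legendre-type
supremum over probability measures supported in `Λ`. -/
theorem pev_dual_representation {V : Type*} (G : SimpleGraph V)
    (hlf : ∀ x, (G.neighborSet x).Finite)
    (hdeg : ∀ x, (G.neighborSet x).Nonempty)
    (Λ : Finset V) (hΛ : Λ.Nonempty) (q : V → ℝ) :
    pev G Λ q = sSup { r | ∃ p : V → ℝ,
      (∀ x, 0 ≤ p x) ∧ (∀ x, p x ≤ 1) ∧ (∀ x ∉ Λ, p x = 0) ∧ (∑ x ∈ Λ, p x = 1) ∧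
      r = (∑ x ∈ Λ, q x * p x) - IEdgeR G p } := by
  classical
  have hpos := degR_pos G hlf hdeg
  rw [pev]
  apply le_antisymm
  · apply csSup_le
    · obtain ⟨x₀, hx₀⟩ := hΛ
      let φ : V → ℝ := Pi.single x₀ (Real.sqrt (degR G x₀))⁻¹
      have hφ : ∀ x ∉ Λ, φ x = 0 := fun x hx =>
        Pi.single_eq_of_ne (fun h : x = x₀ => hx (h ▸ hx₀)) _
      refine ⟨_, φ, hφ, ?_, rfl⟩
      rw [dInner_self_eq_sum G hφ, Finset.sum_eq_single_of_mem x₀ hx₀]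
      · simp [φ, inv_pow, Real.sq_sqrt (hpos x₀).le, (hpos x₀).ne']
      · intro x _ hx
        simp [φ, hx]
    · rintro r ⟨φ, hφ, hnorm, rfl⟩
      rw [sum_degR_mul_lapl_add_mul G hlf hdeg q hφ]
      rw [dInner_self_eq_sum G hφ] at hnorm
      have hnn : ∀ x, 0 ≤ degR G x * φ x ^ 2 := fun x => mul_nonneg (hpos x).le (sq_nonneg _)
      refine le_csSup_of_le ⟨∑ x ∈ Λ, |q x|, ?_⟩
        ⟨fun x => degR G x * φ x ^ 2, hnn, fun x => ?_, fun x hx => by simp [hφ x hx], hnorm, rfl⟩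
        (sub_le_sub_left ?_ _)
      · rintro r ⟨p, hp₀, -, -, hsum, rfl⟩
        rw [IEdgeR_eq_edgeEnergy]
        exact weighted_sum_sub_edgeEnergy_le G q _ (fun x _ => hp₀ x) hsum
      · by_cases hx : x ∈ Λ
        · exact hnorm ▸ Finset.single_le_sum (fun y _ => hnn y) hx
        · simp [hφ x hx]
      · have h : (fun x => Real.sqrt (degR G x * φ x ^ 2 / degR G x)) = fun x => |φ x| := by
          ext x
          rw [mul_div_cancel_left₀ _ (hpos x).ne', Real.sqrt_sq_eq_abs]
        rw [IEdgeR_eq_edgeEnergy, h]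
        exact edgeEnergy_abs_le G hlf hφ
  · apply csSup_le
    · obtain ⟨x₀, hx₀⟩ := hΛ
      have hsingle : ∀ x, (Pi.single x₀ 1 : V → ℝ) x = if x = x₀ then 1 else 0 :=
        fun x => Pi.single_apply x₀ 1 x
      refine ⟨_, Pi.single x₀ 1, fun x => ?_, fun x => ?_, fun x hx => ?_, ?_, rfl⟩
      · rw [hsingle]; split_ifs <;> norm_num
      · rw [hsingle]; split_ifs <;> norm_num
      · rw [hsingle, if_neg fun h : x = x₀ => hx (h ▸ hx₀)]
      · simp [hsingle, hx₀]
    · rintro r ⟨p, hp₀, -, hp, hsum, rfl⟩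
      have hφ : ∀ x ∉ Λ, Real.sqrt (p x / degR G x) = 0 := fun x hx => by simp [hp x hx]
      have hsq : ∀ x, degR G x * Real.sqrt (p x / degR G x) ^ 2 = p x := fun x => by
        rw [Real.sq_sqrt (div_nonneg (hp₀ x) (hpos x).le), mul_div_cancel₀ _ (hpos x).ne']
      refine le_csSup ⟨∑ x ∈ Λ, |q x|, ?_⟩ ⟨fun x => Real.sqrt (p x / degR G x), hφ, ?_, ?_⟩
      · rintro r ⟨φ, hφ, hnorm, rfl⟩
        rw [sum_degR_mul_lapl_add_mul G hlf hdeg q hφ]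
        rw [dInner_self_eq_sum G hφ] at hnorm
        refine weighted_sum_sub_edgeEnergy_le G q φ (fun x _ => ?_) hnorm
        exact mul_nonneg (hpos x).le (sq_nonneg _)
      · rw [dInner_self_eq_sum G hφ, ← hsum]
        exact Finset.sum_congr rfl fun x _ => hsq x
      · rw [sum_degR_mul_lapl_add_mul G hlf hdeg q hφ, IEdgeR_eq_edgeEnergy]
        simp only [hsq]
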